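/- (Transition formula) Let w ∈ S_∞ be a non-identity permutation, let r be the last descent of w (the largest index with w(r) > w(r+1)), let s > r be the unique index with w(s) < w(r) < w(s+1) (taking s maximal with w(s) < w(r)), and set v = w·(r,s), where (r,s) denotes the transposition of r and s. Then 𝔖_w = x_r·𝔖_v + Σ 𝔖_{v·(q,r)}, the sum being over all q < r such that ℓ(v·(q,r)) = ℓ(v) + 1 = ℓ(w). -/

import Mathlib

open MvPolynomial
open scoped Classical

/-- The polynomial ring ℤ[x₁,x₂,…]: the variable with index `i : ℕ` represents `x_{i+1}`. -/
abbrev PolyRing : Type := MvPolynomial ℕ ℤ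

/-- The action of the simple transposition `s_{i+1}` on ℤ[x₁,x₂,…]
(exchanging the variables `x_{i+1}` and `x_{i+2}` and fixing all others). -/
noncomputable def sAct (i : ℕ) (f : PolyRing) : PolyRing :=
  rename (Equiv.swap i (i + 1)) f

/-- The divided difference operator `∂_{i+1}`: the unique polynomial `g` with
`(x_{i+1} - x_{i+2}) * g = f - s_{i+1} f` (it exists, and is unique since the
polynomial ring is a domain). -/
noncomputable def divDiff (i : ℕ) (f : PolyRing) : PolyRing :=
  if h : ∃ g : PolyRing, (X i - X (i + 1)) * g = f - sAct i f then h.choose else 0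

/-- Composite divided difference operator `∂_{a₁} ∘ ∂_{a₂} ∘ ⋯ ∘ ∂_{a_k}` along a word
`a = [a₁, a₂, …, a_k]` (so `∂_{a_k}` is applied first). -/
noncomputable def divDiffWord (a : List ℕ) (f : PolyRing) : PolyRing :=
  a.foldr divDiff f

/-- The length `ℓ(w)` (number of inversions) of a permutation of `{1,2,…}`
(indices shifted down by one, so positions are indexed by `ℕ`). -/
noncomputable def len (w : Equiv.Perm ℕ) : ℕ :=
  Set.ncard {p : ℕ × ℕ | p.1 < p.2 ∧ w p.2 < w p.1}

/-- `a = [a₁, …, a_k]` is a reduced word for `w`: the product of the corresponding simple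
transpositions `s_{a₁} s_{a₂} ⋯ s_{a_k}` is `w` and `k = ℓ(w)`, the number of inversions. -/
def IsReducedWord (w : Equiv.Perm ℕ) (a : List ℕ) : Prop :=
  (a.map fun i => Equiv.swap i (i + 1)).prod = w ∧ a.length = len w

/-- The longest element `w₀` of `S_n` (reversing the first `n` positions, with positions
indexed by `ℕ` starting at `0`). -/
def wZero (n : ℕ) : Equiv.Perm ℕ :=
  Function.Involutive.toPerm (fun i => if i < n then n - 1 - i else i) (by
    intro i
    dsimp only
    split_ifs <;> omega)

/-- The staircase monomial `x₁^{n-1} x₂^{n-2} ⋯ x_{n-1}`, the Schubert polynomial of `w₀`. -/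
noncomputable def staircase (n : ℕ) : PolyRing :=
  ∏ i ∈ Finset.range n, X i ^ (n - 1 - i)

/-- The Schubert polynomial of `w` computed inside `S_n`:
`𝔖_w = ∂_{a₁} ∂_{a₂} ⋯ ∂_{a_k} 𝔖_{w₀}` for a reduced word `w⁻¹ w₀ = s_{a₁} s_{a₂} ⋯ s_{a_k}`
(any choice of reduced word gives the same answer). -/
noncomputable def schubertIn (n : ℕ) (w : Equiv.Perm ℕ) : PolyRing :=
  if h : ∃ a : List ℕ, IsReducedWord (w⁻¹ * wZero n) a then divDiffWord h.choose (staircase n)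
  else 0

/-- The Schubert polynomial `𝔖_w` of a finitely supported permutation `w ∈ S_∞`, computed
inside any `S_n` containing `w` (independent of all choices). -/
noncomputable def schubert (w : Equiv.Perm ℕ) : PolyRing :=
  if h : ∃ n : ℕ, ∀ i, w i ≠ i → i < n then schubertIn h.choose w else 0

/-- simple transposition -/
abbrev S (k : ℕ) : Equiv.Perm ℕ := Equiv.swap k (k + 1)

def Bd (n : ℕ) (w : Equiv.Perm ℕ) : Prop := ∀ i, n ≤ i → w i = i

lemma Bd.lt {n : ℕ} {w : Equiv.Perm ℕ} (h : Bd n w) {i : ℕ} (hi : i < n) : w i < n := by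
  by_contra hc
  have h1 := h (w i) (by omega)
  have := w.injective h1
  omega

lemma Bd.mono {n m : ℕ} {w : Equiv.Perm ℕ} (h : Bd n w) (hm : n ≤ m) : Bd m w :=
  fun i hi => h i (by omega)

lemma Bd.mul {n : ℕ} {w u : Equiv.Perm ℕ} (h : Bd n w) (h' : Bd n u) : Bd n (w * u) := by
  intro i hi
  rw [Equiv.Perm.mul_apply, h' i hi, h i hi]

lemma Bd.inv {n : ℕ} {w : Equiv.Perm ℕ} (h : Bd n w) : Bd n w⁻¹ := by
  intro i hi
  rw [Equiv.Perm.inv_eq_iff_eq, h i hi]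

lemma Bd.swap {n a b : ℕ} (ha : a < n) (hb : b < n) : Bd n (Equiv.swap a b) := by
  intro i hi
  rw [Equiv.swap_apply_of_ne_of_ne] <;> omega

lemma Bd.one (n : ℕ) : Bd n 1 := fun _ _ => rfl

lemma Bd.wZero (n : ℕ) : Bd n (wZero n) := by
  intro i hi
  show (if i < n then n - 1 - i else i) = i
  split_ifs <;> omega

lemma wZero_apply {n i : ℕ} (h : i < n) : wZero n i = n - 1 - i := by
  show (if i < n then n - 1 - i else i) = _
  simp [h]

lemma inv_finite {n : ℕ} {w : Equiv.Perm ℕ} (h : Bd n w) :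
    {p : ℕ × ℕ | p.1 < p.2 ∧ w p.2 < w p.1}.Finite := by
  apply ((Set.finite_Iio n).prod (Set.finite_Iio n)).subset
  rintro ⟨p, q⟩ ⟨h1, h2⟩
  simp only [Set.mem_prod, Set.mem_Iio] at *
  by_contra hc
  have hq : n ≤ q := by omega
  rw [h q hq] at h2
  by_cases hp : p < n
  · have := h.lt hp; omega
  · rw [h p (by omega)] at h2; omega

lemma len_inv (w : Equiv.Perm ℕ) : len w⁻¹ = len w := by
  unfold len
  have : {p : ℕ × ℕ | p.1 < p.2 ∧ w p.2 < w p.1} =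
      (fun p : ℕ × ℕ => (w⁻¹ p.2, w⁻¹ p.1)) '' {p : ℕ × ℕ | p.1 < p.2 ∧ w⁻¹ p.2 < w⁻¹ p.1} := by
    ext ⟨p, q⟩
    simp only [Set.mem_ofPred_eq, Set.mem_image, Prod.mk.injEq, Prod.exists]
    constructor
    · rintro ⟨h1, h2⟩
      exact ⟨w q, w p, by simp [h1, h2]⟩
    · rintro ⟨a, b, ⟨h1, h2⟩, rfl, rfl⟩
      exact ⟨h2, by simpa using h1⟩
  rw [this, Set.ncard_image_of_injective]
  rintro ⟨a, b⟩ ⟨c, d⟩ h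
  simp only [Prod.mk.injEq, EmbeddingLike.apply_eq_iff_eq] at h
  simp [h]

lemma len_mul_S {n k : ℕ} {w : Equiv.Perm ℕ} (hw : Bd n w) (h : w k < w (k + 1)) :
    len (w * S k) = len w + 1 := by
  unfold len
  have : {p : ℕ × ℕ | p.1 < p.2 ∧ (w * S k) p.2 < (w * S k) p.1} =
      insert (k, k + 1) ((fun p : ℕ × ℕ => (S k p.1, S k p.2)) ''
        {p : ℕ × ℕ | p.1 < p.2 ∧ w p.2 < w p.1}) := by
    ext ⟨p, q⟩
    have e : ((p, q) ∈ ((fun p : ℕ × ℕ => (S k p.1, S k p.2)) ''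
        {p : ℕ × ℕ | p.1 < p.2 ∧ w p.2 < w p.1})) ↔
        S k p < S k q ∧ w (S k q) < w (S k p) := by
      simp only [Set.mem_ofPred_eq, Set.mem_image, Prod.mk.injEq, Prod.exists]
      constructor
      · rintro ⟨a, b, ⟨h1, h2⟩, rfl, rfl⟩
        simp [h1, h2]
      · rintro ⟨h1, h2⟩
        exact ⟨S k p, S k q, by simp [h1, h2]⟩
    rw [Set.mem_insert_iff, e]
    simp only [Set.mem_ofPred_eq, Equiv.Perm.mul_apply, Prod.mk.injEq, S, Equiv.swap_apply_def]
    split_ifs <;> subst_vars <;> omega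
  rw [this, Set.ncard_insert_of_notMem _ ((inv_finite hw).image _), Set.ncard_image_of_injective]
  · rintro ⟨a, b⟩ ⟨c, d⟩ h
    simp only [Prod.mk.injEq, EmbeddingLike.apply_eq_iff_eq] at h
    simp [h]
  · simp only [Set.mem_ofPred_eq, Set.mem_image, Prod.mk.injEq, Prod.exists]
    rintro ⟨a, b, ⟨h1, h2⟩, h3, h4⟩
    have ha : a = k + 1 := (S k).injective (by rw [h3]; simp)
    have hb : b = k := (S k).injective (by rw [h4]; simp)
    omega

lemma Bd.mulS {n k : ℕ} {w : Equiv.Perm ℕ} (hw : Bd n w) : Bd (n + k + 2) (w * S k) :=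
  (hw.mono (by omega)).mul (Bd.swap (by omega) (by omega))

lemma len_mul_S' {n k : ℕ} {w : Equiv.Perm ℕ} (hw : Bd n w) (h : w (k + 1) < w k) :
    len (w * S k) + 1 = len w := by
  have := len_mul_S (k := k) (hw.mulS (k := k)) (by simpa [S] using h)
  rw [mul_assoc, Equiv.swap_mul_self, mul_one] at this
  exact this.symm

lemma len_S_mul {n k : ℕ} {w : Equiv.Perm ℕ} (hw : Bd n w) (h : w⁻¹ k < w⁻¹ (k + 1)) :
    len (S k * w) = len w + 1 := by
  rw [← len_inv, mul_inv_rev, Equiv.swap_inv, len_mul_S hw.inv h, len_inv]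

lemma len_S_mul' {n k : ℕ} {w : Equiv.Perm ℕ} (hw : Bd n w) (h : w⁻¹ (k + 1) < w⁻¹ k) :
    len (S k * w) + 1 = len w := by
  rw [← len_inv, mul_inv_rev, Equiv.swap_inv, len_mul_S' hw.inv h, len_inv]

lemma ne_succ (w : Equiv.Perm ℕ) (k : ℕ) : w k ≠ w (k + 1) := by
  intro h
  have := w.injective h
  omega

lemma exists_descent {n : ℕ} {w : Equiv.Perm ℕ} (hw : Bd n w) (h1 : w ≠ 1) :
    ∃ k, w (k + 1) < w k := by
  by_contra hc
  push Not at hc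
  have hm : StrictMono w := strictMono_nat_of_lt_succ fun k => lt_of_le_of_ne (hc k) (ne_succ w k)
  apply h1
  have key : ∀ i, i ≤ w i := fun i => hm.le_apply
  have hm' : StrictMono (w⁻¹ : Equiv.Perm ℕ) := by
    intro a b hab
    rw [← hm.lt_iff_lt]
    simpa using hab
  have key' : ∀ i, i ≤ w⁻¹ i := fun i => hm'.le_apply
  ext i
  have h2 := key i
  have h3 := key' (w i)
  simp at h3
  simp
  omega

lemma exists_ascent {n : ℕ} {w : Equiv.Perm ℕ} (hw : Bd n w) (h1 : w ≠ wZero n) :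
    ∃ k, k + 1 < n ∧ w k < w (k + 1) := by
  have h2 : wZero n * w ≠ 1 := by
    intro h
    apply h1
    rw [mul_eq_one_iff_inv_eq] at h
    rw [← h]
    ext i
    rw [Equiv.Perm.inv_eq_iff_eq]
    show i = (if (if i < n then n - 1 - i else i) < n then n - 1 - (if i < n then n - 1 - i else i)
      else (if i < n then n - 1 - i else i))
    split_ifs <;> omega
  obtain ⟨k, hk⟩ := exists_descent ((Bd.wZero n).mul hw) h2
  simp only [Equiv.Perm.mul_apply] at hk
  by_cases h : k + 1 < n
  · refine ⟨k, h, ?_⟩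
    have a := hw.lt h
    have b := hw.lt (show k < n by omega)
    rw [wZero_apply a, wZero_apply b] at hk
    omega
  · have a := ((Bd.wZero n).mul hw) (k + 1) (by omega)
    simp only [Equiv.Perm.mul_apply] at a
    rw [a] at hk
    by_cases h' : k < n
    · have := ((Bd.wZero n).mul hw).lt h'
      simp only [Equiv.Perm.mul_apply] at this
      omega
    · have a := ((Bd.wZero n).mul hw) k (by omega)
      simp only [Equiv.Perm.mul_apply] at a
      omega

lemma len_one : len 1 = 0 := by
  unfold len
  convert Set.ncard_empty (ℕ × ℕ)
  ext p
  simp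
  omega

/-- length change under a transposition -/
lemma len_swap_aux (a d : ℕ) : ∀ (n : ℕ) (v : Equiv.Perm ℕ), Bd n v → v a < v (a + d + 1) →
    (len v + 1 ≤ len (v * Equiv.swap a (a + d + 1))) ∧
    ((∀ c, a < c → c < a + d + 1 → ¬ (v a < v c ∧ v c < v (a + d + 1))) →
      len (v * Equiv.swap a (a + d + 1)) = len v + 1) ∧
    ((∃ c, a < c ∧ c < a + d + 1 ∧ v a < v c ∧ v c < v (a + d + 1)) →
      len v + 1 < len (v * Equiv.swap a (a + d + 1))) := by
  induction d with
  | zero =>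
    intro n v hv h
    have := len_mul_S hv h
    refine ⟨this.ge, fun _ => this, ?_⟩
    rintro ⟨c, h1, h2, _⟩
    omega
  | succ d ih =>
    intro n v hv h
    set b := a + d + 1 with hb
    have hb' : a + (d + 1) + 1 = b + 1 := by omega
    rw [hb'] at h ⊢
    have e1 : Equiv.swap a (b + 1) = S b * Equiv.swap a b * S b := by
      have := Equiv.swap_mul_swap_mul_swap (x := a) (y := b) (z := b + 1) (by omega) (by omega)
      rw [Equiv.swap_comm a (b + 1), ← this]
    set u := v * S b with hu
    have hub : Bd (n + b + 2) u := hv.mulS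
    have ua : u a = v a := by
      simp only [hu, Equiv.Perm.mul_apply]
      rw [Equiv.swap_apply_of_ne_of_ne] <;> omega
    have ub : u b = v (b + 1) := by simp [hu]
    have ub1 : u (b + 1) = v b := by simp [hu]
    have uo : ∀ c, a < c → c < b → u c = v c := by
      intro c h1 h2
      simp only [hu, Equiv.Perm.mul_apply]
      rw [Equiv.swap_apply_of_ne_of_ne] <;> omega
    have e2 : v * Equiv.swap a (b + 1) = (u * Equiv.swap a b) * S b := by
      rw [e1, hu]; group
    have hub' : Bd (n + b + 2) (u * Equiv.swap a b) := hub.mul (Bd.swap (by omega) (by omega))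
    set y := u * Equiv.swap a b with hy
    have yb : y b = v a := by simp [hy, ua]
    have yb1 : y (b + 1) = v b := by
      simp only [hy, Equiv.Perm.mul_apply]
      rw [Equiv.swap_apply_of_ne_of_ne, ub1] <;> omega
    rw [e2]
    obtain ⟨i1, i2, i3⟩ := ih _ u hub (by rw [ua, ub]; exact h)
    rw [← hy] at i1 i2 i3
    rw [ua, ub] at i2 i3
    have nb1 : v b ≠ v a := fun h => by have := v.injective h; omega
    have nb2 : v b ≠ v (b + 1) := ne_succ v b
    have hcase : (∃ c, a < c ∧ c < b + 1 ∧ v a < v c ∧ v c < v (b + 1)) ↔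
        (v a < v b ∧ v b < v (b + 1)) ∨ (∃ c, a < c ∧ c < b ∧ v a < u c ∧ u c < v (b + 1)) := by
      constructor
      · rintro ⟨c, h1, h2, h3⟩
        by_cases hc : c = b
        · subst hc; exact Or.inl h3
        · refine Or.inr ⟨c, h1, by omega, ?_⟩
          rw [uo c h1 (by omega)]; exact h3
      · rintro (h1 | ⟨c, h1, h2, h3⟩)
        · exact ⟨b, by omega, by omega, h1⟩
        · rw [uo c h1 h2] at h3
          exact ⟨c, h1, by omega, h3⟩
    have hneg : (∀ c, a < c → c < b + 1 → ¬ (v a < v c ∧ v c < v (b + 1))) ↔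
      ¬ (∃ c, a < c ∧ c < b + 1 ∧ v a < v c ∧ v c < v (b + 1)) := by
      push Not; rfl
    have hneg' : (∀ c, a < c → c < b → ¬ (v a < u c ∧ u c < v (b + 1))) ↔
      ¬ (∃ c, a < c ∧ c < b ∧ v a < u c ∧ u c < v (b + 1)) := by
      push Not; rfl
    rw [hneg, hcase]
    rw [hneg'] at i2
    generalize (∃ c, a < c ∧ c < b ∧ v a < u c ∧ u c < v (b + 1)) = P at i2 i3 ⊢
    rcases lt_or_gt_of_ne nb1 with g1 | g1
    · have l1 : len u = len v + 1 := len_mul_S hv (by omega)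
      have l2 := len_mul_S' (k := b) hub' (by omega)
      by_cases hP : P
      · have i3 := i3 hP
        exact ⟨by omega, fun h => absurd (Or.inr hP) h, fun _ => by omega⟩
      · have i2 := i2 hP
        exact ⟨by omega, fun h => by omega, fun h => by have := h.resolve_right hP; omega⟩
    rcases lt_or_gt_of_ne nb2 with g2 | g2
    · have l1 : len u = len v + 1 := len_mul_S hv (by omega)
      have l2 := len_mul_S (k := b) hub' (by omega)
      by_cases hP : P
      · have i3 := i3 hP
        exact ⟨by omega, fun h => absurd (Or.inr hP) h, fun _ => by omega⟩
      · have i2 := i2 hP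
        exact ⟨by omega, fun h => absurd (Or.inl ⟨g1, g2⟩) h, fun _ => by omega⟩
    · have l1 : len u + 1 = len v := len_mul_S' hv (by omega)
      have l2 := len_mul_S (k := b) hub' (by omega)
      by_cases hP : P
      · have i3 := i3 hP
        exact ⟨by omega, fun h => absurd (Or.inr hP) h, fun _ => by omega⟩
      · have i2 := i2 hP
        exact ⟨by omega, fun h => by omega, fun h => by have := h.resolve_right hP; omega⟩

lemma cover_iff {n a b : ℕ} {v : Equiv.Perm ℕ} (hv : Bd n v) (hab : a < b) :
    len (v * Equiv.swap a b) = len v + 1 ↔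
      (v a < v b ∧ ∀ c, a < c → c < b → ¬ (v a < v c ∧ v c < v b)) := by
  obtain ⟨d, rfl⟩ : ∃ d, b = a + d + 1 := ⟨b - a - 1, by omega⟩
  constructor
  · intro h
    have hlt : v a < v (a + d + 1) := by
      by_contra hc
      have hne : v a ≠ v (a + d + 1) := fun h => by have := v.injective h; omega
      have hb : Bd (n + a + d + 2) (v * Equiv.swap a (a + d + 1)) :=
        (hv.mono (by omega)).mul (Bd.swap (by omega) (by omega))
      have := (len_swap_aux a d _ _ hb (by simp; omega)).1
      rw [mul_assoc, Equiv.swap_mul_self, mul_one] at this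
      omega
    refine ⟨hlt, ?_⟩
    intro c h1 h2 h3
    have := (len_swap_aux a d n v hv hlt).2.2 ⟨c, h1, h2, h3⟩
    omega
  · rintro ⟨h1, h2⟩
    exact (len_swap_aux a d n v hv h1).2.1 h2

/-! ### Divided differences -/

lemma sAct_add (i : ℕ) (f g : PolyRing) : sAct i (f + g) = sAct i f + sAct i g := map_add _ _ _
lemma sAct_sub (i : ℕ) (f g : PolyRing) : sAct i (f - g) = sAct i f - sAct i g := map_sub _ _ _
lemma sAct_mul (i : ℕ) (f g : PolyRing) : sAct i (f * g) = sAct i f * sAct i g := map_mul _ _ _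
lemma sAct_X (i j : ℕ) : sAct i (X j) = X (S i j) := rename_X _ _
lemma sAct_C (i : ℕ) (c : ℤ) : sAct i (C c) = C c := rename_C _ _
lemma sAct_sAct (i : ℕ) (f : PolyRing) : sAct i (sAct i f) = f := by
  unfold sAct
  rw [rename_rename]
  have : (⇑(Equiv.swap i (i + 1)) ∘ ⇑(Equiv.swap i (i + 1))) = id := by
    funext j; simp
  rw [this, rename_id_apply]

lemma sAct_braid (i : ℕ) (f : PolyRing) :
    sAct i (sAct (i + 1) (sAct i f)) = sAct (i + 1) (sAct i (sAct (i + 1) f)) := by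
  unfold sAct
  simp only [rename_rename]
  congr 2
  funext m
  simp only [Function.comp_apply, Equiv.swap_apply_def]
  split_ifs <;> omega

lemma sAct_comm {i j : ℕ} (h : i + 1 < j) (f : PolyRing) :
    sAct i (sAct j f) = sAct j (sAct i f) := by
  unfold sAct
  simp only [rename_rename]
  congr 2
  funext m
  simp only [Function.comp_apply, Equiv.swap_apply_def]
  split_ifs <;> omega

lemma X_sub_ne {i j : ℕ} (h : i ≠ j) : (X i - X j : PolyRing) ≠ 0 := by
  rw [sub_ne_zero]
  intro h'
  exact h (X_injective h')

lemma divDiff_exists (i : ℕ) (f : PolyRing) :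
    ∃ g : PolyRing, (X i - X (i + 1)) * g = f - sAct i f := by
  induction f using MvPolynomial.induction_on with
  | C a => exact ⟨0, by rw [sAct_C]; ring⟩
  | add p q hp hq =>
    obtain ⟨g, hg⟩ := hp
    obtain ⟨g', hg'⟩ := hq
    exact ⟨g + g', by rw [sAct_add]; linear_combination hg + hg'⟩
  | mul_X p j hp =>
    obtain ⟨g, hg⟩ := hp
    have : ∃ c : PolyRing, (X i - X (i + 1)) * c = X j - sAct i (X j) := by
      rw [sAct_X]
      by_cases h1 : j = i
      · subst h1; exact ⟨1, by simp⟩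
      by_cases h2 : j = i + 1
      · subst h2; exact ⟨-1, by simp⟩
      · exact ⟨0, by rw [Equiv.swap_apply_of_ne_of_ne h1 h2]; ring⟩
    obtain ⟨c, hc⟩ := this
    refine ⟨c * p + sAct i (X j) * g, ?_⟩
    rw [sAct_mul]
    linear_combination p * hc + sAct i (X j) * hg

lemma divDiff_spec (i : ℕ) (f : PolyRing) :
    (X i - X (i + 1)) * divDiff i f = f - sAct i f := by
  unfold divDiff
  rw [dif_pos (divDiff_exists i f)]
  exact (divDiff_exists i f).choose_spec

lemma divDiff_eq {i : ℕ} {f g : PolyRing} (h : (X i - X (i + 1)) * g = f - sAct i f) :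
    divDiff i f = g := by
  apply mul_left_cancel₀ (X_sub_ne (show i ≠ i + 1 by omega))
  rw [divDiff_spec, h]

lemma divDiff_add (i : ℕ) (f g : PolyRing) : divDiff i (f + g) = divDiff i f + divDiff i g := by
  apply divDiff_eq
  rw [sAct_add]
  linear_combination divDiff_spec i f + divDiff_spec i g

/-- divided difference as an additive map -/
noncomputable def dd (i : ℕ) : PolyRing →+ PolyRing := AddMonoidHom.mk' (divDiff i) (divDiff_add i)

lemma dd_apply (i : ℕ) (f : PolyRing) : dd i f = divDiff i f := rfl

lemma divDiff_mul (i : ℕ) (f g : PolyRing) :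
    divDiff i (f * g) = divDiff i f * g + sAct i f * divDiff i g := by
  apply divDiff_eq
  rw [sAct_mul]
  linear_combination g * divDiff_spec i f + sAct i f * divDiff_spec i g

lemma sAct_divDiff (i : ℕ) (f : PolyRing) : sAct i (divDiff i f) = divDiff i f := by
  have h1 := divDiff_spec i f
  have h2 := congrArg (sAct i) h1
  rw [sAct_mul, sAct_sub, sAct_sub, sAct_X, sAct_X, sAct_sAct, Equiv.swap_apply_left,
    Equiv.swap_apply_right] at h2
  apply mul_left_cancel₀ (X_sub_ne (show i ≠ i + 1 by omega))
  linear_combination - h1 - h2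

lemma divDiff_of_symm {i : ℕ} {f : PolyRing} (h : sAct i f = f) : divDiff i f = 0 :=
  divDiff_eq (by rw [h]; ring)

lemma divDiff_divDiff (i : ℕ) (f : PolyRing) : divDiff i (divDiff i f) = 0 :=
  divDiff_of_symm (sAct_divDiff i f)

lemma divDiff_X_mul {i : ℕ} {h : PolyRing} (hs : sAct i h = h) : divDiff i (X i * h) = h := by
  apply divDiff_eq
  rw [sAct_mul, hs, sAct_X, Equiv.swap_apply_left]
  ring

lemma divDiff_comm {i j : ℕ} (h : i + 1 < j) (f : PolyRing) :
    divDiff i (divDiff j f) = divDiff j (divDiff i f) := by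
  apply mul_left_cancel₀ (mul_ne_zero (X_sub_ne (show i ≠ i + 1 by omega))
    (X_sub_ne (show j ≠ j + 1 by omega)))
  have a1 := divDiff_spec i (divDiff j f)
  have a2 := divDiff_spec j (divDiff i f)
  have b1 := divDiff_spec i f
  have b2 := divDiff_spec j f
  have c1 := congrArg (sAct j) b1
  have c2 := congrArg (sAct i) b2
  have e1 : S j i = i := Equiv.swap_apply_of_ne_of_ne (by omega) (by omega)
  have e2 : S j (i + 1) = i + 1 := Equiv.swap_apply_of_ne_of_ne (by omega) (by omega)
  have e3 : S i j = j := Equiv.swap_apply_of_ne_of_ne (by omega) (by omega)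
  have e4 : S i (j + 1) = j + 1 := Equiv.swap_apply_of_ne_of_ne (by omega) (by omega)
  simp only [sAct_mul, sAct_sub, sAct_X, e1, e2, e3, e4] at c1 c2
  rw [← sAct_comm h] at c1
  linear_combination (X j - X (j + 1)) * a1 - (X i - X (i + 1)) * a2 + b2 - c2 - b1 + c1

lemma divDiff_braid (i : ℕ) (f : PolyRing) :
    divDiff i (divDiff (i + 1) (divDiff i f)) =
      divDiff (i + 1) (divDiff i (divDiff (i + 1) f)) := by
  have e1 : S i i = i + 1 := Equiv.swap_apply_left _ _
  have e2 : S i (i + 1) = i := Equiv.swap_apply_right _ _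
  have e3 : S i (i + 1 + 1) = i + 1 + 1 := Equiv.swap_apply_of_ne_of_ne (by omega) (by omega)
  have e4 : S (i + 1) i = i := Equiv.swap_apply_of_ne_of_ne (by omega) (by omega)
  have e5 : S (i + 1) (i + 1) = i + 1 + 1 := Equiv.swap_apply_left _ _
  have e6 : S (i + 1) (i + 1 + 1) = i + 1 := Equiv.swap_apply_right _ _
  apply mul_left_cancel₀ (mul_ne_zero (mul_ne_zero (X_sub_ne (show i ≠ i + 1 by omega))
    (X_sub_ne (show i + 1 ≠ i + 1 + 1 by omega))) (X_sub_ne (show i ≠ i + 1 + 1 by omega)))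
  set a : PolyRing := X i
  set b : PolyRing := X (i + 1)
  set c : PolyRing := X (i + 1 + 1)
  have L : (a - b) * (b - c) * (a - c) * divDiff i (divDiff (i + 1) (divDiff i f)) =
      f - sAct i f - sAct (i + 1) f + sAct (i + 1) (sAct i f) + sAct i (sAct (i + 1) f)
        - sAct i (sAct (i + 1) (sAct i f)) := by
    have h1 := divDiff_spec i f
    have h2 := divDiff_spec (i + 1) (divDiff i f)
    have h3 := divDiff_spec i (divDiff (i + 1) (divDiff i f))
    have h4 := congrArg (sAct i) h2
    have h5 := congrArg (sAct (i + 1)) h1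
    have h6 := congrArg (sAct i) h5
    simp only [sAct_mul, sAct_sub, sAct_X, e1, e2, e3, e4, e5, e6, sAct_divDiff] at h4 h5 h6
    linear_combination (b - c) * (a - c) * h3 + (a - c) * h2 - (b - c) * h4 + h1 - h5 + h6
  have R : (a - b) * (b - c) * (a - c) * divDiff (i + 1) (divDiff i (divDiff (i + 1) f)) =
      f - sAct i f - sAct (i + 1) f + sAct (i + 1) (sAct i f) + sAct i (sAct (i + 1) f)
        - sAct (i + 1) (sAct i (sAct (i + 1) f)) := by
    have h1 := divDiff_spec (i + 1) f
    have h2 := divDiff_spec i (divDiff (i + 1) f)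
    have h3 := divDiff_spec (i + 1) (divDiff i (divDiff (i + 1) f))
    have h4 := congrArg (sAct (i + 1)) h2
    have h5 := congrArg (sAct i) h1
    have h6 := congrArg (sAct (i + 1)) h5
    simp only [sAct_mul, sAct_sub, sAct_X, e1, e2, e3, e4, e5, e6, sAct_divDiff] at h4 h5 h6
    linear_combination (a - b) * (a - c) * h3 + (a - c) * h2 - (a - b) * h4 + h1 - h5 + h6
  rw [L, R, sAct_braid]

lemma divDiff_hom {i d : ℕ} {f : PolyRing} (hf : f.IsHomogeneous (d + 1)) :
    (divDiff i f).IsHomogeneous d := by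
  set g := divDiff i f with hg
  have hp : (X i - X (i + 1) : PolyRing).IsHomogeneous 1 :=
    (isHomogeneous_X _ _).sub (isHomogeneous_X _ _)
  have h1 : (f - sAct i f).IsHomogeneous (d + 1) := hf.sub hf.rename_isHomogeneous
  have h2 : divDiff i f = homogeneousComponent d g := by
    apply divDiff_eq
    have h3 := congrArg (homogeneousComponent (d + 1)) (divDiff_spec i f)
    rw [homogeneousComponent_eq_self h1, ← hg] at h3
    rw [← h3]
    conv_rhs => rw [← sum_homogeneousComponent g, Finset.mul_sum, map_sum]
    have h4 : ∀ j, homogeneousComponent (d + 1) ((X i - X (i + 1)) * homogeneousComponent j g) =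
        if j = d then (X i - X (i + 1)) * homogeneousComponent d g else 0 := by
      intro j
      have : ((X i - X (i + 1)) * homogeneousComponent j g).IsHomogeneous (1 + j) :=
        hp.mul (homogeneousComponent_isHomogeneous _ _)
      rw [homogeneousComponent_of_mem this]
      by_cases hj : j = d
      · subst hj; rw [if_pos (by omega), if_pos rfl]
      · rw [if_neg (by omega), if_neg hj]
    simp only [h4, Finset.sum_ite_eq', Finset.mem_range]
    split_ifs with h
    · rfl
    · rw [homogeneousComponent_eq_zero, mul_zero]
      omega
  rw [hg, h2]
  exact homogeneousComponent_isHomogeneous _ _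

lemma divDiff_C (i : ℕ) (c : ℤ) : divDiff i (C c) = 0 := divDiff_of_symm (sAct_C i c)

lemma hom_zero_eq_C {f : PolyRing} (hf : f.IsHomogeneous 0) : f = C (coeff 0 f) := by
  rw [← homogeneousComponent_zero, homogeneousComponent_eq_self hf]

lemma divDiff_hom' {i d : ℕ} {f : PolyRing} (hf : f.IsHomogeneous d) :
    ∃ d', (divDiff i f).IsHomogeneous d' := by
  cases d with
  | zero => exact ⟨0, by rw [hom_zero_eq_C hf, divDiff_C]; exact isHomogeneous_zero _ _ _⟩
  | succ d => exact ⟨d, divDiff_hom hf⟩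

lemma divDiffWord_hom (a : List ℕ) {d : ℕ} {f : PolyRing} (hf : f.IsHomogeneous d) :
    ∃ d', (divDiffWord a f).IsHomogeneous d' := by
  induction a with
  | nil => exact ⟨d, hf⟩
  | cons i a ih =>
    obtain ⟨d', h⟩ := ih
    exact divDiff_hom' h

lemma const_of_divDiff {f : PolyRing} (h : ∀ k, divDiff k f = 0) : f = C (coeff 0 f) := by
  have hs : ∀ k, sAct k f = f := by
    intro k
    have := divDiff_spec k f
    rw [h k, mul_zero] at this
    exact (sub_eq_zero.mp this.symm).symm
  have h1 : ∀ k, degreeOf (k + 1) f = degreeOf k f := by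
    intro k
    have := degreeOf_rename_of_injective (p := f) (Equiv.swap k (k + 1)).injective k
    rw [Equiv.swap_apply_left] at this
    rw [← this]
    congr 1
    exact (hs k).symm
  have h2 : ∀ k, degreeOf k f = degreeOf 0 f := by
    intro k
    induction k with
    | zero => rfl
    | succ k ih => rw [h1, ih]
  rw [← vars_eq_empty_iff_eq_C]
  by_contra hne
  obtain ⟨i, hi⟩ := Finset.nonempty_iff_ne_empty.mpr hne
  rw [mem_vars_iff_degreeOf_ne_zero, h2] at hi
  obtain ⟨j, hj⟩ := Infinite.exists_notMem_finset f.vars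
  apply hj
  rw [mem_vars_iff_degreeOf_ne_zero, h2]
  exact hi

/-! ### Reduced words -/

lemma exists_reduced {n : ℕ} {u : Equiv.Perm ℕ} (hu : Bd n u) : ∃ a, IsReducedWord u a := by
  induction hm : len u using Nat.strong_induction_on generalizing n u with
  | _ m ih =>
    by_cases h1 : u = 1
    · subst h1; exact ⟨[], by simp [IsReducedWord, len_one]⟩
    · obtain ⟨k, hk⟩ := exists_descent hu.inv (by simpa using h1)
      have hl := len_S_mul' hu hk
      have hb : Bd (n + k + 2) (S k * u) :=
        (Bd.swap (by omega) (by omega)).mul (hu.mono (by omega))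
      obtain ⟨a, ha1, ha2⟩ := ih _ (by omega) hb rfl
      refine ⟨k :: a, ?_, ?_⟩
      · rw [List.map_cons, List.prod_cons, ha1, ← mul_assoc, Equiv.swap_mul_self, one_mul]
      · rw [List.length_cons, ha2, hl]

lemma word_bd (a : List ℕ) : ∃ n, Bd n (a.map fun i => Equiv.swap i (i + 1)).prod := by
  induction a with
  | nil => exact ⟨0, by simpa using Bd.one 0⟩
  | cons k a ih =>
    obtain ⟨n, hn⟩ := ih
    refine ⟨n + k + 2, ?_⟩
    rw [List.map_cons, List.prod_cons]
    exact (Bd.swap (by omega) (by omega)).mul (hn.mono (by omega))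

lemma len_word_le (a : List ℕ) : len (a.map fun i => Equiv.swap i (i + 1)).prod ≤ a.length := by
  induction a with
  | nil => simp [len_one]
  | cons k a ih =>
    obtain ⟨n, hn⟩ := word_bd a
    rw [List.map_cons, List.prod_cons, List.length_cons]
    set u := (a.map fun i => Equiv.swap i (i + 1)).prod
    show len (S k * u) ≤ _
    rcases lt_or_gt_of_ne (ne_succ u⁻¹ k) with h | h
    · have := len_S_mul hn h; omega
    · have := len_S_mul' hn h; omega

lemma IsReducedWord.bd {u : Equiv.Perm ℕ} {a : List ℕ} (h : IsReducedWord u a) : ∃ n, Bd n u := by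
  rw [← h.1]; exact word_bd a

lemma IsReducedWord.uncons {u : Equiv.Perm ℕ} {i : ℕ} {a : List ℕ}
    (h : IsReducedWord u (i :: a)) : IsReducedWord (S i * u) a ∧ u⁻¹ (i + 1) < u⁻¹ i := by
  obtain ⟨n, hn⟩ := h.bd
  obtain ⟨h1, h2⟩ := h
  have e : (a.map fun i => Equiv.swap i (i + 1)).prod = S i * u := by
    rw [← h1, List.map_cons, List.prod_cons, ← mul_assoc, Equiv.swap_mul_self, one_mul]
  have hle := len_word_le a
  rw [e] at hle
  rw [List.length_cons] at h2
  rcases lt_or_gt_of_ne (ne_succ u⁻¹ i) with h | h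
  · have := len_S_mul hn h; omega
  · have := len_S_mul' hn h
    exact ⟨⟨e, by omega⟩, h⟩

lemma IsReducedWord.cons {u : Equiv.Perm ℕ} {i : ℕ} {a : List ℕ}
    (h : IsReducedWord (S i * u) a) (hd : u⁻¹ (i + 1) < u⁻¹ i) : IsReducedWord u (i :: a) := by
  obtain ⟨n, hn⟩ := h.bd
  have hb : Bd (n + i + 2) u := by
    have : u = S i * (S i * u) := by rw [← mul_assoc, Equiv.swap_mul_self, one_mul]
    rw [this]
    exact (Bd.swap (by omega) (by omega)).mul (hn.mono (by omega))
  refine ⟨?_, ?_⟩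
  · rw [List.map_cons, List.prod_cons, h.1, ← mul_assoc, Equiv.swap_mul_self, one_mul]
  · rw [List.length_cons, h.2, len_S_mul' hb hd]

lemma inv_S_mul (u : Equiv.Perm ℕ) (i j : ℕ) : (S i * u)⁻¹ j = u⁻¹ (S i j) := by
  rw [mul_inv_rev, Equiv.swap_inv, Equiv.Perm.mul_apply]

lemma S_comm {i j : ℕ} (h : i + 1 < j) : S i * S j = S j * S i := by
  ext m
  simp only [Equiv.Perm.mul_apply, Equiv.swap_apply_def]
  split_ifs <;> omega

lemma S_braid (i : ℕ) : S i * (S (i + 1) * S i) = S (i + 1) * (S i * S (i + 1)) := by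
  ext m
  simp only [Equiv.Perm.mul_apply, Equiv.swap_apply_def]
  split_ifs <;> omega

lemma matsumoto (m : ℕ) : ∀ (u : Equiv.Perm ℕ), len u = m → ∀ a b, IsReducedWord u a →
    IsReducedWord u b → ∀ f, divDiffWord a f = divDiffWord b f := by
  induction m using Nat.strong_induction_on with
  | _ m ih =>
  intro u hu
  have key : ∀ i j a b, i < j → IsReducedWord u (i :: a) → IsReducedWord u (j :: b) →
      ∀ f, divDiffWord (i :: a) f = divDiffWord (j :: b) f := by
    intro i j a b hij ha hb f
    obtain ⟨n, hn⟩ := ha.bd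
    have hla := ha.2
    have hlb := hb.2
    obtain ⟨ha, hia⟩ := ha.uncons
    obtain ⟨hb, hjb⟩ := hb.uncons
    have la := ha.2
    have lb := hb.2
    rw [List.length_cons] at hla hlb
    show divDiff i (divDiffWord a f) = divDiff j (divDiffWord b f)
    by_cases hj : j = i + 1
    · subst hj
      have e1 : S i i = i + 1 := Equiv.swap_apply_left _ _
      have e2 : S i (i + 1) = i := Equiv.swap_apply_right _ _
      have e3 : S i (i + 1 + 1) = i + 1 + 1 := Equiv.swap_apply_of_ne_of_ne (by omega) (by omega)
      have e4 : S (i + 1) i = i := Equiv.swap_apply_of_ne_of_ne (by omega) (by omega)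
      have e5 : S (i + 1) (i + 1) = i + 1 + 1 := Equiv.swap_apply_left _ _
      have e6 : S (i + 1) (i + 1 + 1) = i + 1 := Equiv.swap_apply_right _ _
      have hB : Bd (n + i + 3) (S i * (S (i + 1) * (S i * u))) :=
        (Bd.swap (by omega) (by omega)).mul ((Bd.swap (by omega) (by omega)).mul
          ((Bd.swap (by omega) (by omega)).mul (hn.mono (by omega))))
      obtain ⟨c, hc⟩ := exists_reduced hB
      have hc' : IsReducedWord (S (i + 1) * (S i * (S (i + 1) * u))) c := by
        have : S (i + 1) * (S i * (S (i + 1) * u)) = S i * (S (i + 1) * (S i * u)) := by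
          have := congrArg (· * u) (S_braid i)
          simp only [mul_assoc] at this
          exact this.symm
        rw [this]; exact hc
      have h1 : IsReducedWord (S i * u) ((i + 1) :: i :: c) := by
        refine (hc.cons ?_).cons ?_
        · simp only [inv_S_mul, e1, e2, e3, e4, e5, e6]; exact hjb
        · simp only [inv_S_mul, e1, e2, e3, e4, e5, e6]; omega
      have h2 : IsReducedWord (S (i + 1) * u) (i :: (i + 1) :: c) := by
        refine (hc'.cons ?_).cons ?_
        · simp only [inv_S_mul, e1, e2, e3, e4, e5, e6]; exact hia
        · simp only [inv_S_mul, e1, e2, e3, e4, e5, e6]; omega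
      rw [ih _ (by omega) _ rfl _ _ ha h1 f, ih _ (by omega) _ rfl _ _ hb h2 f]
      exact divDiff_braid i _
    · have hij' : i + 1 < j := by omega
      have e1 : S j i = i := Equiv.swap_apply_of_ne_of_ne (by omega) (by omega)
      have e2 : S j (i + 1) = i + 1 := Equiv.swap_apply_of_ne_of_ne (by omega) (by omega)
      have e3 : S i j = j := Equiv.swap_apply_of_ne_of_ne (by omega) (by omega)
      have e4 : S i (j + 1) = j + 1 := Equiv.swap_apply_of_ne_of_ne (by omega) (by omega)
      have hB : Bd (n + j + 3) (S j * (S i * u)) :=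
        (Bd.swap (by omega) (by omega)).mul ((Bd.swap (by omega) (by omega)).mul
          (hn.mono (by omega)))
      obtain ⟨c, hc⟩ := exists_reduced hB
      have hc' : IsReducedWord (S i * (S j * u)) c := by
        rw [← mul_assoc, S_comm hij', mul_assoc]; exact hc
      have h1 : IsReducedWord (S i * u) (j :: c) := by
        refine hc.cons ?_
        simp only [inv_S_mul, e3, e4]; exact hjb
      have h2 : IsReducedWord (S j * u) (i :: c) := by
        refine hc'.cons ?_
        simp only [inv_S_mul, e1, e2]; exact hia
      rw [ih _ (by omega) _ rfl _ _ ha h1 f, ih _ (by omega) _ rfl _ _ hb h2 f]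
      exact divDiff_comm hij' _
  intro a b ha hb f
  cases a with
  | nil =>
    have h1 := ha.2
    have h2 := hb.2
    rw [← h1] at h2
    rw [List.length_eq_zero_iff.mp h2]
  | cons i a =>
    cases b with
    | nil =>
      have h1 := ha.2
      have h2 := hb.2
      rw [← h2] at h1
      simp at h1
    | cons j b =>
      rcases lt_trichotomy i j with h | h | h
      · exact key i j a b h ha hb f
      · subst h
        have la := ha.2
        have hl := ha.uncons.1.2
        rw [List.length_cons] at la
        show divDiff i (divDiffWord a f) = divDiff i (divDiffWord b f)
        rw [ih _ (by omega) _ rfl _ _ ha.uncons.1 hb.uncons.1 f]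
      · exact (key j i b a h hb ha f).symm

/-! ### Schubert polynomials -/

lemma schubertIn_eq {n : ℕ} {w : Equiv.Perm ℕ} {a : List ℕ}
    (h : IsReducedWord (w⁻¹ * wZero n) a) : schubertIn n w = divDiffWord a (staircase n) := by
  have hex : ∃ a : List ℕ, IsReducedWord (w⁻¹ * wZero n) a := ⟨a, h⟩
  unfold schubertIn
  rw [dif_pos hex]
  exact matsumoto _ _ rfl _ _ hex.choose_spec h _

lemma wZero_inv (n : ℕ) : (wZero n)⁻¹ = wZero n := rfl

lemma desc_aux {n k : ℕ} {w : Equiv.Perm ℕ} (hw : Bd n w) (hk : k + 1 < n)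
    (h : w k < w (k + 1)) : (w⁻¹ * wZero n)⁻¹ (k + 1) < (w⁻¹ * wZero n)⁻¹ k := by
  rw [mul_inv_rev, inv_inv, wZero_inv, Equiv.Perm.mul_apply, Equiv.Perm.mul_apply]
  have a := hw.lt hk
  have b := hw.lt (show k < n by omega)
  rw [wZero_apply a, wZero_apply b]
  omega

lemma schubertIn_step {n k : ℕ} {w : Equiv.Perm ℕ} (hw : Bd n w) (hk : k + 1 < n)
    (h : w k < w (k + 1)) : schubertIn n w = divDiff k (schubertIn n (w * S k)) := by
  have hb : Bd n (w * S k) := hw.mul (Bd.swap (by omega) (by omega))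
  obtain ⟨a, ha⟩ := exists_reduced (hb.inv.mul (Bd.wZero n))
  rw [schubertIn_eq ha]
  have e : (w * S k)⁻¹ * wZero n = S k * (w⁻¹ * wZero n) := by
    rw [mul_inv_rev, Equiv.swap_inv, mul_assoc]
  rw [e] at ha
  rw [schubertIn_eq (ha.cons (desc_aux hw hk h))]
  rfl

lemma schubertIn_wZero (n : ℕ) : schubertIn n (wZero n) = staircase n := by
  have : IsReducedWord ((wZero n)⁻¹ * wZero n) [] := by
    rw [inv_mul_cancel]; simp [IsReducedWord, len_one]
  rw [schubertIn_eq this]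
  rfl

lemma staircase_succ (n : ℕ) : staircase (n + 1) = staircase n * ∏ i ∈ Finset.Ico 0 n, X i := by
  unfold staircase
  rw [Finset.prod_range_succ, ← Finset.range_eq_Ico, ← Finset.prod_mul_distrib]
  simp only [Nat.add_sub_cancel, Nat.sub_self, pow_zero, mul_one]
  apply Finset.prod_congr rfl
  intro i hi
  rw [Finset.mem_range] at hi
  rw [← pow_succ]
  congr 1
  omega

lemma stair_symm {n j : ℕ} (hj : j < n) :
    sAct j (staircase n * ∏ i ∈ Finset.Ico (j + 1) n, X i) =
      staircase n * ∏ i ∈ Finset.Ico (j + 1) n, X i := by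
  set e : ℕ → ℕ := fun i => (n - 1 - i) + if j < i ∧ i < n then 1 else 0 with he
  have h1 : staircase n = ∏ i ∈ Finset.range (n + 1), X i ^ (n - 1 - i) := by
    rw [Finset.prod_range_succ, show n - 1 - n = 0 by omega, pow_zero, mul_one]
    rfl
  have h2 : (∏ i ∈ Finset.Ico (j + 1) n, X i : PolyRing) =
      ∏ i ∈ Finset.range (n + 1), X i ^ (if j < i ∧ i < n then 1 else 0) := by
    simp only [pow_ite, pow_one, pow_zero]
    rw [← Finset.prod_filter]
    apply Finset.prod_congr _ (fun _ _ => rfl)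
    ext i
    simp only [Finset.mem_Ico, Finset.mem_filter, Finset.mem_range]
    omega
  have h3 : staircase n * ∏ i ∈ Finset.Ico (j + 1) n, X i =
      ∏ i ∈ Finset.range (n + 1), X i ^ e i := by
    rw [h2, h1, ← Finset.prod_mul_distrib]
    apply Finset.prod_congr rfl
    intro i _
    rw [he, pow_add]
  rw [h3]
  unfold sAct
  rw [map_prod]
  simp only [map_pow, rename_X]
  apply Finset.prod_equiv (Equiv.swap j (j + 1))
  · intro i
    simp only [Finset.mem_range, Equiv.swap_apply_def]
    split_ifs <;> omega
  · intro i _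
    congr 1
    simp only [he, Equiv.swap_apply_def]
    split_ifs <;> omega

/-- intermediate permutations between the longest elements -/
noncomputable def Y (n : ℕ) : ℕ → Equiv.Perm ℕ
  | 0 => wZero (n + 1)
  | j + 1 => Y n j * S j

lemma Y_apply (n j : ℕ) (hj : j ≤ n) (i : ℕ) : Y n j i =
    if i < j then n - 1 - i else if i = j then n else if i ≤ n then n - i else i := by
  induction j generalizing i with
  | zero =>
    show (if i < n + 1 then n + 1 - 1 - i else i) = _
    split_ifs <;> omega
  | succ j ih =>
    rw [Y, Equiv.Perm.mul_apply, ih (by omega)]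
    simp only [Equiv.swap_apply_def]
    split_ifs <;> omega

lemma Y_schub (n j : ℕ) (hj : j ≤ n) :
    schubertIn (n + 1) (Y n j) = staircase n * ∏ i ∈ Finset.Ico j n, X i := by
  induction j with
  | zero => rw [Y, schubertIn_wZero, staircase_succ]
  | succ j ih =>
    have hb : Bd (n + 1) (Y n (j + 1)) := by
      intro i hi
      rw [Y_apply n _ hj]
      split_ifs <;> omega
    rw [schubertIn_step (k := j) hb (by omega)]
    · have : Y n (j + 1) * S j = Y n j := by
        rw [Y, mul_assoc, Equiv.swap_mul_self, mul_one]
      rw [this, ih (by omega), Finset.prod_eq_prod_Ico_succ_bot (by omega), mul_left_comm]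
      exact divDiff_X_mul (stair_symm (by omega))
    · rw [Y_apply n _ hj, Y_apply n _ hj]
      split_ifs <;> omega

lemma schubertIn_succ_wZero (n : ℕ) : schubertIn (n + 1) (wZero n) = staircase n := by
  have : wZero n = Y n n := by
    ext i
    rw [Y_apply n n le_rfl]
    show (if i < n then n - 1 - i else i) = _
    split_ifs <;> omega
  rw [this, Y_schub n n le_rfl]
  simp

lemma schubertIn_succ {n : ℕ} {w : Equiv.Perm ℕ} (hw : Bd n w) :
    schubertIn n w = schubertIn (n + 1) w := by
  induction hm : len (w⁻¹ * wZero n) using Nat.strong_induction_on generalizing w with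
  | _ m ih =>
  by_cases h0 : w = wZero n
  · rw [h0, schubertIn_wZero, schubertIn_succ_wZero]
  · obtain ⟨k, hk, h⟩ := exists_ascent hw h0
    have hb : Bd n (w * S k) := hw.mul (Bd.swap (by omega) (by omega))
    have e : (w * S k)⁻¹ * wZero n = S k * (w⁻¹ * wZero n) := by
      rw [mul_inv_rev, Equiv.swap_inv, mul_assoc]
    have hl := len_S_mul' (hw.inv.mul (Bd.wZero n)) (desc_aux hw hk h)
    rw [schubertIn_step hw hk h, schubertIn_step (hw.mono (Nat.le_succ n)) (by omega) h,
      ih (len (S k * (w⁻¹ * wZero n))) (by omega) hb (by rw [e])]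

lemma schubertIn_mono {n m : ℕ} {w : Equiv.Perm ℕ} (hw : Bd n w) (h : n ≤ m) :
    schubertIn n w = schubertIn m w := by
  induction m, h using Nat.le_induction with
  | base => rfl
  | succ m hm ih => rw [ih, schubertIn_succ (hw.mono hm)]

lemma schubert_eq {n : ℕ} {w : Equiv.Perm ℕ} (hw : Bd n w) : schubert w = schubertIn n w := by
  have h : ∃ n : ℕ, ∀ i, w i ≠ i → i < n :=
    ⟨n, fun i hi => by by_contra hc; exact hi (hw i (by omega))⟩
  unfold schubert
  rw [dif_pos h]
  have hb : Bd h.choose w := by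
    intro i hi
    by_contra hc
    have := h.choose_spec i hc
    omega
  rw [schubertIn_mono hb (le_max_left _ n), schubertIn_mono hw (le_max_right h.choose n)]

lemma schubert_step {n k : ℕ} {w : Equiv.Perm ℕ} (hw : Bd n w) (h : w k < w (k + 1)) :
    schubert w = divDiff k (schubert (w * S k)) := by
  rw [schubert_eq (hw.mulS (k := k)), schubert_eq (hw.mono (show n ≤ n + k + 2 by omega))]
  exact schubertIn_step (hw.mono (by omega)) (by omega) h

lemma divDiff_schubert_asc {n k : ℕ} {w : Equiv.Perm ℕ} (hw : Bd n w) (h : w k < w (k + 1)) :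
    divDiff k (schubert w) = 0 := by
  rw [schubert_step hw h, divDiff_divDiff]

lemma divDiff_schubert_desc {n k : ℕ} {w : Equiv.Perm ℕ} (hw : Bd n w) (h : w (k + 1) < w k) :
    divDiff k (schubert w) = schubert (w * S k) := by
  rw [schubert_step (k := k) (w := w * S k) hw.mulS (by simpa [S] using h), mul_assoc,
    Equiv.swap_mul_self, mul_one]

lemma schubert_one : schubert 1 = 1 := by
  have h : (1 : Equiv.Perm ℕ) = wZero 0 := by
    ext i
    rw [Bd.wZero 0 i (by omega)]
    rfl
  rw [schubert_eq (Bd.one 0), h, schubertIn_wZero]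
  simp [staircase]

lemma schubert_ne_zero {n : ℕ} {w : Equiv.Perm ℕ} (hw : Bd n w) : schubert w ≠ 0 := by
  induction hm : len w using Nat.strong_induction_on generalizing n w with
  | _ m ih =>
  by_cases h1 : w = 1
  · rw [h1, schubert_one]; exact one_ne_zero
  · obtain ⟨k, hk⟩ := exists_descent hw h1
    have hl := len_mul_S' hw hk
    intro h0
    apply ih _ (by omega) (hw.mulS (k := k)) rfl
    rw [← divDiff_schubert_desc hw hk, h0, ← dd_apply, map_zero]

lemma staircase_hom (n : ℕ) : ∃ d, (staircase n).IsHomogeneous d :=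
  ⟨_, IsHomogeneous.prod _ _ _ fun i _ => isHomogeneous_X_pow i _⟩

lemma schubert_hom {n : ℕ} {w : Equiv.Perm ℕ} (hw : Bd n w) :
    ∃ d, (schubert w).IsHomogeneous d := by
  obtain ⟨a, ha⟩ := exists_reduced (hw.inv.mul (Bd.wZero n))
  obtain ⟨d, hd⟩ := staircase_hom n
  rw [schubert_eq hw, schubertIn_eq ha]
  exact divDiffWord_hom a hd

lemma schubert_coeff_zero {n : ℕ} {w : Equiv.Perm ℕ} (hw : Bd n w) (h1 : w ≠ 1) :
    coeff 0 (schubert w) = 0 := by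
  obtain ⟨d, hd⟩ := schubert_hom hw
  cases d with
  | zero =>
    exfalso
    obtain ⟨k, hk⟩ := exists_descent hw h1
    apply schubert_ne_zero (hw.mulS (k := k))
    rw [← divDiff_schubert_desc hw hk, hom_zero_eq_C hd, divDiff_C]
  | succ d => exact hd.coeff_eq_zero (by simp)

/-! ### the Monk rule for multiplication by a variable -/

lemma asc_aux {n a b k : ℕ} {v : Equiv.Perm ℕ} (hv : Bd n v) (hab : a < b)
    (hc : len (v * Equiv.swap a b) = len v + 1) (hk : v k < v (k + 1))
    (hne : ¬ (a = k ∧ b = k + 1)) :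
    (v * Equiv.swap a b) k < (v * Equiv.swap a b) (k + 1) := by
  rw [cover_iff hv hab] at hc
  obtain ⟨h1, h2⟩ := hc
  have i1 : v k = v a → k = a := fun h => v.injective h
  have i2 : v k = v b → k = b := fun h => v.injective h
  have i3 : v (k + 1) = v a → k + 1 = a := fun h => v.injective h
  have i4 : v (k + 1) = v b → k + 1 = b := fun h => v.injective h
  have j1 := h2 k
  have j2 := h2 (k + 1)
  simp only [Equiv.Perm.mul_apply, Equiv.swap_apply_def]
  split_ifs <;> subst_vars <;> omega

lemma asc_cov {n r j k : ℕ} {v : Equiv.Perm ℕ} (hv : Bd n v)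
    (hc : len (v * Equiv.swap r j) = len v + 1) (hk : v k < v (k + 1))
    (hne : Equiv.swap r j ≠ S k) :
    (v * Equiv.swap r j) k < (v * Equiv.swap r j) (k + 1) := by
  rcases lt_trichotomy r j with h | h | h
  · exact asc_aux hv h hc hk (by rintro ⟨rfl, rfl⟩; exact hne rfl)
  · subst h
    rw [Equiv.swap_self] at hc
    change len (v * 1) = _ at hc
    rw [mul_one] at hc
    omega
  · rw [Equiv.swap_comm] at hc hne ⊢
    exact asc_aux hv h hc hk (by rintro ⟨rfl, rfl⟩; exact hne rfl)

lemma desc_cov {n r j k : ℕ} {v : Equiv.Perm ℕ} (hv : Bd n v)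
    (hc : len (v * Equiv.swap r j) + 1 = len v) (hk : v (k + 1) < v k)
    (hne : Equiv.swap r j ≠ S k) :
    (v * Equiv.swap r j) (k + 1) < (v * Equiv.swap r j) k := by
  by_contra h
  have hlt : (v * Equiv.swap r j) k < (v * Equiv.swap r j) (k + 1) :=
    lt_of_le_of_ne (not_lt.mp h) (ne_succ _ k)
  have e : v * Equiv.swap r j * Equiv.swap r j = v := by
    rw [mul_assoc, Equiv.swap_mul_self, mul_one]
  have hb : Bd (n + r + j + 1) (v * Equiv.swap r j) :=
    (hv.mono (by omega)).mul (Bd.swap (by omega) (by omega))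
  have := asc_cov hb (r := r) (j := j) (by rw [e]; omega) hlt hne
  rw [e] at this
  omega

def sg (r j : ℕ) : ℤ := if r < j then 1 else -1

/-- signed terms of the Monk rule -/
noncomputable def T (v : Equiv.Perm ℕ) (r j : ℕ) : PolyRing :=
  if len (v * Equiv.swap r j) = len v + 1 then sg r j • schubert (v * Equiv.swap r j) else 0

lemma T_self (v : Equiv.Perm ℕ) (r : ℕ) : T v r r = 0 := by
  unfold T
  rw [Equiv.swap_self]
  change (if len (v * 1) = len v + 1 then _ else _) = _
  rw [mul_one, if_neg (by omega)]

lemma swap_eq_S {r j k : ℕ} (h : Equiv.swap r j = S k) :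
    (r = k ∧ j = k + 1) ∨ (r = k + 1 ∧ j = k) := by
  have h1 := congrArg (fun e : Equiv.Perm ℕ => e k) h
  have h2 := congrArg (fun e : Equiv.Perm ℕ => e (k + 1)) h
  simp only [S, Equiv.swap_apply_def] at h1 h2
  split_ifs at h1 h2 <;> omega

lemma dT_asc {n k : ℕ} {v : Equiv.Perm ℕ} (hv : Bd n v) (hk : v k < v (k + 1)) (r j : ℕ) :
    dd k (T v r j) = if Equiv.swap r j = S k then sg r j • schubert v else 0 := by
  unfold T
  by_cases h : Equiv.swap r j = S k
  · rw [if_pos h, h, if_pos (len_mul_S hv hk), map_zsmul, dd_apply,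
      divDiff_schubert_desc (hv.mulS (k := k)) (by simpa [S] using hk), mul_assoc,
      Equiv.swap_mul_self, mul_one]
  · rw [if_neg h]
    split_ifs with hc
    · have hb : Bd (n + r + j + 1) (v * Equiv.swap r j) :=
        (hv.mono (by omega)).mul (Bd.swap (by omega) (by omega))
      rw [map_zsmul, dd_apply, divDiff_schubert_asc hb (asc_cov hv hc hk h), smul_zero]
    · exact map_zero _

lemma swap_conj_S (k r j : ℕ) : S k * Equiv.swap (S k r) (S k j) = Equiv.swap r j * S k := by
  rw [Equiv.swap_apply_apply]
  simp only [Equiv.swap_inv]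
  rw [← mul_assoc, ← mul_assoc, Equiv.swap_mul_self, one_mul]

lemma dT_desc {n k : ℕ} {v : Equiv.Perm ℕ} (hv : Bd n v) (hk : v (k + 1) < v k) (r j : ℕ) :
    dd k (T v r j) = T (v * S k) (S k r) (S k j) +
      if Equiv.swap r j = S k then sg r j • schubert v else 0 := by
  have hl := len_mul_S' hv hk
  have e : v * S k * Equiv.swap (S k r) (S k j) = v * Equiv.swap r j * S k := by
    rw [mul_assoc, swap_conj_S, mul_assoc]
  by_cases hrj : r = j
  · subst hrj
    rw [T_self, T_self, map_zero, if_neg, add_zero]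
    intro h
    have := swap_eq_S h
    omega
  by_cases h : Equiv.swap r j = S k
  · rw [if_pos h]
    have e2 : v * Equiv.swap r j * S k = v := by
      rw [h, mul_assoc, Equiv.swap_mul_self, mul_one]
    have e3 : sg (S k r) (S k j) = - sg r j := by
      rcases swap_eq_S h with ⟨rfl, rfl⟩ | ⟨rfl, rfl⟩ <;> simp [S, sg]
    unfold T
    rw [e, e2, h, if_neg (by omega), if_pos (by omega), e3, map_zero, neg_smul, neg_add_cancel]
  · rw [if_neg h, add_zero]
    have e3 : sg (S k r) (S k j) = sg r j := by
      have h1 : ¬ (r = k ∧ j = k + 1) := by rintro ⟨rfl, rfl⟩; exact h rfl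
      have h2 : ¬ (r = k + 1 ∧ j = k) := by rintro ⟨rfl, rfl⟩; exact h (Equiv.swap_comm _ _)
      unfold sg
      congr 1
      simp only [S, Equiv.swap_apply_def, eq_iff_iff]
      split_ifs <;> omega
    have hb : Bd (n + r + j + 1) (v * Equiv.swap r j) :=
      (hv.mono (by omega)).mul (Bd.swap (by omega) (by omega))
    unfold T
    rw [e, e3]
    rcases lt_or_gt_of_ne (ne_succ (v * Equiv.swap r j) k) with g | g
    · have l1 := len_mul_S hb g
      rw [if_neg (c := len (v * Equiv.swap r j * S k) = _)]
      · split_ifs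
        · rw [map_zsmul, dd_apply, divDiff_schubert_asc hb g, smul_zero]
        · exact map_zero _
      · intro hh
        have := desc_cov hv (r := r) (j := j) (by omega) hk h
        omega
    · have l1 := len_mul_S' hb g
      by_cases hc : len (v * Equiv.swap r j) = len v + 1
      · rw [if_pos hc, if_pos (by omega), map_zsmul, dd_apply, divDiff_schubert_desc hb g]
      · rw [if_neg hc, if_neg (by omega), map_zero]

lemma sum_delta {r k N : ℕ} (hr : r + 1 < N) (f : PolyRing) :
    ∑ j ∈ Finset.range N, (if Equiv.swap r j = S k then sg r j • f else 0) =
      divDiff k (X r) * f := by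
  by_cases h1 : r = k
  · subst h1
    have e : divDiff r (X r) = 1 := by
      apply divDiff_eq
      rw [sAct_X, Equiv.swap_apply_left, mul_one]
    rw [e, one_mul, Finset.sum_eq_single (r + 1)]
    · rw [if_pos rfl]; simp [sg]
    · intro j _ hj
      rw [if_neg]
      intro h
      have := swap_eq_S h
      omega
    · intro h; simp at h; omega
  by_cases h2 : r = k + 1
  · subst h2
    have e : divDiff k (X (k + 1)) = -1 := by
      apply divDiff_eq
      rw [sAct_X, Equiv.swap_apply_right]; ring
    rw [e, Finset.sum_eq_single k]
    · rw [if_pos (Equiv.swap_comm _ _)]; simp [sg]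
    · intro j _ hj
      rw [if_neg]
      intro h
      have := swap_eq_S h
      omega
    · intro h; simp at h; omega
  · have e : divDiff k (X r) = 0 := by
      apply divDiff_of_symm
      rw [sAct_X, Equiv.swap_apply_of_ne_of_ne h1 h2]
    rw [e, zero_mul]
    apply Finset.sum_eq_zero
    intro j _
    rw [if_neg]
    intro h
    have := swap_eq_S h
    omega

lemma Bd.desc_lt {n k : ℕ} {v : Equiv.Perm ℕ} (hv : Bd n v) (hk : v (k + 1) < v k) :
    k + 1 < n := by
  by_contra h
  rw [hv (k + 1) (by omega)] at hk
  by_cases h' : k < n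
  · have := hv.lt h'; omega
  · rw [hv k (by omega)] at hk; omega

lemma monk (m : ℕ) : ∀ (v : Equiv.Perm ℕ) (n r N : ℕ), len v = m → Bd n v → n < N → r + 1 < N →
    X r * schubert v = ∑ j ∈ Finset.range N, T v r j := by
  induction m using Nat.strong_induction_on with
  | _ m ih =>
  intro v n r N hm hv hn hr
  rw [← sub_eq_zero]
  have h0 : ∀ k, divDiff k (X r * schubert v - ∑ j ∈ Finset.range N, T v r j) = 0 := by
    intro k
    rw [← dd_apply, map_sub, map_sum, dd_apply, divDiff_mul, sAct_X]
    rcases lt_or_gt_of_ne (ne_succ v k) with h | h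
    · simp only [dT_asc hv h]
      rw [sum_delta hr, divDiff_schubert_asc hv h]
      ring
    · have hkn := hv.desc_lt h
      simp only [dT_desc hv h]
      rw [Finset.sum_add_distrib, sum_delta hr, divDiff_schubert_desc hv h]
      have hl := len_mul_S' hv h
      have hb : Bd n (v * S k) := hv.mul (Bd.swap (by omega) (by omega))
      have hr' : S k r + 1 < N := by
        simp only [S, Equiv.swap_apply_def]
        split_ifs <;> omega
      rw [ih _ (by omega) (v * S k) n (S k r) N rfl hb hn hr']
      have : ∑ j ∈ Finset.range N, T (v * S k) (S k r) j =
          ∑ j ∈ Finset.range N, T (v * S k) (S k r) (S k j) := by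
        symm
        apply Finset.sum_equiv (S k)
        · intro i
          simp only [Finset.mem_range, S, Equiv.swap_apply_def]
          split_ifs <;> omega
        · intro i _; rfl
      rw [this]
      ring
  rw [const_of_divDiff h0]
  have : coeff 0 (X r * schubert v - ∑ j ∈ Finset.range N, T v r j) = 0 := by
    rw [← constantCoeff_eq, map_sub, map_mul, constantCoeff_X, zero_mul, map_sum,
      Finset.sum_eq_zero, sub_zero]
    intro j _
    unfold T
    split_ifs with hc
    · have hb : Bd (n + r + j + 1) (v * Equiv.swap r j) :=
        (hv.mono (by omega)).mul (Bd.swap (by omega) (by omega))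
      rw [map_zsmul, constantCoeff_eq, schubert_coeff_zero hb, smul_zero]
      intro h
      rw [h, len_one] at hc
      omega
    · exact map_zero _
  rw [this, C_0]

/-- Transition formula: Let `w ∈ S_∞` be a non-identity finitely supported
permutation (positions indexed by `ℕ`, shifted down by one from the 1-based indexing), let
`r` be the last descent of `w` (the largest index with `w(r) > w(r+1)`), let `s > r` be the
unique index with `w(s) < w(r) < w(s+1)`, and set `v = w·(r,s)` where `(r,s)` is the
transposition of `r` and `s`.  Then `𝔖_w = x_r·𝔖_v + Σ 𝔖_{v·(q,r)}`, the sum over all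
`q < r` with `ℓ(v·(q,r)) = ℓ(v) + 1 = ℓ(w)`. -/
theorem schubert_transition (w : Equiv.Perm ℕ) (hw : {i : ℕ | w i ≠ i}.Finite) (hw1 : w ≠ 1)
    (r s : ℕ)
    (hr : w (r + 1) < w r) (hrlast : ∀ j, r < j → w j < w (j + 1))
    (hrs : r < s) (hs1 : w s < w r) (hs2 : w r < w (s + 1)) :
    schubert w =
      X r * schubert (w * Equiv.swap r s) +
      ∑ q ∈ (Finset.range r).filter
          (fun q => len (w * Equiv.swap r s * Equiv.swap q r)
              = len (w * Equiv.swap r s) + 1 ∧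
            len (w * Equiv.swap r s) + 1 = len w),
        schubert (w * Equiv.swap r s * Equiv.swap q r) := by
  obtain ⟨n, hn⟩ : ∃ n, Bd n w := by
    obtain ⟨M, hM⟩ := hw.bddAbove
    refine ⟨M + 1, fun i hi => ?_⟩
    by_contra hc
    have := hM (show i ∈ {i : ℕ | w i ≠ i} from hc)
    omega
  have hmono : ∀ i j, r < i → i < j → w i < w j := by
    intro i j hi hij
    induction j, hij using Nat.le_induction with
    | base => exact hrlast i hi
    | succ j hj ih => exact ih.trans (hrlast j (by omega))
  set v := w * Equiv.swap r s with hv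
  have hvb : Bd (n + s + 1) v := (hn.mono (by omega)).mul (Bd.swap (by omega) (by omega))
  have hvs : v * Equiv.swap r s = w := by
    rw [hv, mul_assoc, Equiv.swap_mul_self, mul_one]
  have vr : v r = w s := by simp [hv]
  have vs : v s = w r := by simp [hv]
  have vo : ∀ c, c ≠ r → c ≠ s → v c = w c := by
    intro c h1 h2
    rw [hv, Equiv.Perm.mul_apply, Equiv.swap_apply_of_ne_of_ne h1 h2]
  have hcov : ∀ j, r < j → (len (v * Equiv.swap r j) = len v + 1 ↔ j = s) := by
    intro j hj
    rw [cover_iff hvb hj]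
    constructor
    · rintro ⟨h1, h2⟩
      by_contra hne
      rw [vo j (by omega) hne, vr] at h1
      rcases lt_or_gt_of_ne hne with h | h
      · have := hmono j s hj h
        omega
      · apply h2 s hrs h
        rw [vr, vs, vo j (by omega) hne]
        refine ⟨hs1, ?_⟩
        rcases Nat.eq_or_lt_of_le (show s + 1 ≤ j from h) with g | g
        · rw [← g]; exact hs2
        · exact hs2.trans (hmono (s + 1) j (by omega) g)
    · rintro rfl
      rw [vr, vs]
      refine ⟨hs1, fun c h1 h2 h3 => ?_⟩
      rw [vo c (by omega) (by omega)] at h3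
      have := hmono c j h1 h2
      omega
  have hlen : len v + 1 = len w := by
    have := (hcov s hrs).mpr rfl
    rw [hvs] at this
    exact this.symm
  have hmonk := monk _ v _ r (n + s + 2) rfl hvb (by omega) (by omega)
  have hT : ∀ j, T v r j = (if j = s then schubert w else 0) -
      (if j < r ∧ len (v * Equiv.swap j r) = len v + 1 ∧ len v + 1 = len w then
        schubert (v * Equiv.swap j r) else 0) := by
    intro j
    rcases lt_trichotomy r j with h | h | h
    · rw [if_neg (c := j < r ∧ _) (by omega), sub_zero]
      unfold T
      by_cases hj : j = s
      · rw [if_pos hj, if_pos ((hcov j h).mpr hj), hj, hvs, sg, if_pos hrs, one_smul]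
      · rw [if_neg hj, if_neg]
        rw [hcov j h]; exact hj
    · subst h
      rw [T_self, if_neg (by omega), if_neg (by omega), sub_zero]
    · rw [if_neg (c := j = s) (by omega), zero_sub]
      unfold T
      rw [Equiv.swap_comm r j]
      by_cases hc : len (v * Equiv.swap j r) = len v + 1
      · rw [if_pos hc, if_pos ⟨h, hc, hlen⟩, sg, if_neg (by omega), neg_smul, one_smul]
      · rw [if_neg hc, if_neg (by tauto), neg_zero]
  rw [hmonk]
  simp only [hT]
  rw [Finset.sum_sub_distrib, Finset.sum_ite_eq', if_pos (by simp; omega), ← Finset.sum_filter]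
  have : Finset.filter (fun j => j < r ∧ len (v * Equiv.swap j r) = len v + 1 ∧
        len v + 1 = len w) (Finset.range (n + s + 2)) =
      (Finset.range r).filter (fun q => len (v * Equiv.swap q r) = len v + 1 ∧
        len v + 1 = len w) := by
    ext q
    simp only [Finset.mem_filter, Finset.mem_range]
    constructor
    · rintro ⟨_, h⟩; exact h
    · rintro h; exact ⟨by omega, h⟩
  rw [this, sub_add_cancel]
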